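/- Let (M,η,H) be a contact Hamiltonian system and Y a vector field on M. Then Y is a Cartan symmetry, i.e. there exist a, g ∈ C^∞(M) with L_Y η = a η + dg and Y(H) = a H + g R(H), if and only if its Hamiltonian–horizontal decomposition has the form Y = X_{φ_Y} + δ_Y with horizontal part δ_Y = X_g + g R (where φ_Y = −η(Y)), the function φ_Y + g is in involution with the Hamiltonian, {φ_Y + g, H}_η = 0, and a = −R(φ_Y + g). -/

import Mathlib

open scoped BigOperators

/-- Vector fields on the "manifold" whose algebra of smooth functions is `R`,
modeled as ℝ-linear derivations of `R`. -/
abbrev VectorFieldOn (R : Type*) [CommRing R] [Algebra ℝ R] : Type _ := Derivation ℝ R R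

/-- The exterior derivative of a 1-form (an `R`-linear functional on vector fields),
via the intrinsic (Koszul) formula `dη(X,Y) = X(η(Y)) - Y(η(X)) - η([X,Y])`. -/
def dForm {R : Type*} [CommRing R] [Algebra ℝ R]
    (η : VectorFieldOn R →ₗ[R] R) (X Y : VectorFieldOn R) : R :=
  X (η Y) - Y (η X) - η ⁅X, Y⁆

/-- An exact contact manifold of dimension `2n+1`, described through its algebra of
smooth functions `R`: a contact form `eta`, nondegenerate and of maximal rank, with
its Reeb vector field and the contact Hamiltonian vector field assignment `ham`,
each characterized by the usual defining equations (together with uniqueness, which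
is what the contact condition `η ∧ (dη)^n ≠ 0` grants). -/
structure ExactContact (R : Type*) [CommRing R] [Algebra ℝ R] where
  n : ℕ
  eta : VectorFieldOn R →ₗ[R] R
  nondeg : ∀ Z : VectorFieldOn R, eta Z = 0 → (∀ Y, dForm eta Z Y = 0) → Z = 0
  dim_le : ∀ ω : AlternatingMap R (VectorFieldOn R) R (Fin (2 * n + 2)), ω = 0
  reeb : VectorFieldOn R
  reeb_eta : eta reeb = 1
  reeb_dEta : ∀ Y, dForm eta reeb Y = 0
  reeb_unique : ∀ Z, eta Z = 1 → (∀ Y, dForm eta Z Y = 0) → Z = reeb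
  ham : R → VectorFieldOn R
  ham_eta : ∀ f, eta (ham f) = -f
  ham_dEta : ∀ f Y, dForm eta (ham f) Y = Y f - reeb f * eta Y
  ham_unique : ∀ f Z, eta Z = -f → (∀ Y, dForm eta Z Y = Y f - reeb f * eta Y) → Z = ham f

/-- The Jacobi bracket induced by the contact form: `{f,g}_η = X_f(g) + g R(f)`. -/
def ExactContact.jacobi {R : Type*} [CommRing R] [Algebra ℝ R]
    (C : ExactContact R) (f g : R) : R :=
  C.ham f g + g * C.reeb f

theorem dForm_add_left {R : Type*} [CommRing R] [Algebra ℝ R]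
    (η : VectorFieldOn R →ₗ[R] R) (X Y Z : VectorFieldOn R) :
    dForm η (X + Y) Z = dForm η X Z + dForm η Y Z := by
  simp only [dForm, add_lie, map_add, Derivation.add_apply]
  ring

theorem dForm_sub_left {R : Type*} [CommRing R] [Algebra ℝ R]
    (η : VectorFieldOn R →ₗ[R] R) (X Y Z : VectorFieldOn R) :
    dForm η (X - Y) Z = dForm η X Z - dForm η Y Z := by
  simp only [dForm, sub_lie, map_sub, Derivation.sub_apply]
  ring

theorem dForm_smul_left {R : Type*} [CommRing R] [Algebra ℝ R]
    (η : VectorFieldOn R →ₗ[R] R) (f : R) (X Z : VectorFieldOn R) :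
    dForm η (f • X) Z = f * dForm η X Z := by
  have h : ⁅f • X, Z⁆ = f • ⁅X, Z⁆ - Z f • X := by
    ext r
    simp only [Derivation.commutator_apply, Derivation.sub_apply, Derivation.smul_apply,
      smul_eq_mul, Derivation.leibniz]
    ring
  simp only [dForm, h, map_sub, map_smul, Derivation.smul_apply, smul_eq_mul,
    Derivation.leibniz]
  ring

theorem dForm_swap {R : Type*} [CommRing R] [Algebra ℝ R]
    (η : VectorFieldOn R →ₗ[R] R) (X Y : VectorFieldOn R) :
    dForm η X Y = -dForm η Y X := by
  rw [dForm, dForm, ← lie_skew Y X, map_neg]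
  ring

namespace ExactContact

variable {R : Type*} [CommRing R] [Algebra ℝ R] (C : ExactContact R)

theorem ham_add (f g : R) : C.ham (f + g) = C.ham f + C.ham g := by
  refine (C.ham_unique _ _ ?_ fun Z => ?_).symm
  · rw [map_add, C.ham_eta, C.ham_eta]
    ring
  · rw [dForm_add_left, C.ham_dEta, C.ham_dEta, map_add, map_add]
    ring

/-- A vector field is determined by the values of `η` and `dη` on it. -/
theorem eq_of_eta_eq_of_dForm_eq {X Y : VectorFieldOn R} (h : C.eta X = C.eta Y)
    (hd : ∀ Z, dForm C.eta X Z = dForm C.eta Y Z) : X = Y := by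
  refine sub_eq_zero.mp (C.nondeg _ ?_ fun Z => ?_)
  · rw [map_sub, h, sub_self]
  · rw [dForm_sub_left, hd, sub_self]

/-- The Lie derivative condition `L_Y η = a η + dg`, read off from the decomposition of `Y`. -/
theorem lieDeriv_eta_eq_iff (Y : VectorFieldOn R) (a g : R) :
    (∀ Z : VectorFieldOn R, Y (C.eta Z) - C.eta ⁅Y, Z⁆ = a * C.eta Z + Z g) ↔
      Y = C.ham (-C.eta Y + g) + g • C.reeb ∧ a = -C.reeb (-C.eta Y + g) := by
  have key (Z : VectorFieldOn R) :
      dForm C.eta (C.ham (-C.eta Y + g) + g • C.reeb) Z =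
        Z (-C.eta Y + g) - C.reeb (-C.eta Y + g) * C.eta Z := by
    rw [dForm_add_left, dForm_smul_left, C.reeb_dEta, C.ham_dEta, mul_zero, add_zero]
  have lie (Z : VectorFieldOn R) :
      Y (C.eta Z) - C.eta ⁅Y, Z⁆ = dForm C.eta Y Z + Z (C.eta Y) := by
    rw [dForm]
    ring
  constructor
  · intro h
    have ha : a = -C.reeb (-C.eta Y + g) := by
      have hR := h C.reeb
      rw [lie, dForm_swap, C.reeb_dEta, C.reeb_eta] at hR
      rw [map_add, map_neg]
      linear_combination -hR
    refine ⟨C.eq_of_eta_eq_of_dForm_eq ?_ fun Z => ?_, ha⟩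
    · rw [map_add, map_smul, C.ham_eta, C.reeb_eta, smul_eq_mul]
      ring
    · have hZ := h Z
      rw [lie, ha] at hZ
      rw [key, map_add Z, map_neg Z]
      linear_combination hZ
  · rintro ⟨hY, ha⟩ Z
    have hZ := key Z
    rw [← hY, map_add Z, map_neg Z] at hZ
    rw [lie, hZ, ha]
    ring

end ExactContact

/-- `Y` is a Cartan symmetry with data `a, g` (`L_Y η = a η + dg` and
`Y(H) = aH + g R(H)`) iff its Hamiltonian–horizontal decomposition has horizontal
part `δ_Y = X_g + g R`, `{φ_Y + g, H}_η = 0`, and `a = -R(φ_Y + g)`, where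
`φ_Y = -η(Y)`. -/
theorem cartan_symmetry_iff {R : Type*} [CommRing R] [Algebra ℝ R]
    (C : ExactContact R) (H : R) (Y : VectorFieldOn R) :
    ∀ a g : R,
      ((∀ Z : VectorFieldOn R, Y (C.eta Z) - C.eta ⁅Y, Z⁆ = a * C.eta Z + Z g) ∧
          Y H = a * H + g * C.reeb H) ↔
        (Y - C.ham (-C.eta Y) = C.ham g + g • C.reeb ∧
          C.jacobi (-C.eta Y + g) H = 0 ∧
          a = -C.reeb (-C.eta Y + g)) := by
  intro a g
  have hdec : Y - C.ham (-C.eta Y) = C.ham g + g • C.reeb ↔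
      Y = C.ham (-C.eta Y + g) + g • C.reeb := by
    rw [C.ham_add, sub_eq_iff_eq_add', add_assoc]
  rw [C.lieDeriv_eta_eq_iff, hdec, and_assoc, and_congr_right_iff]
  intro hY
  rw [and_comm, and_congr_left_iff]
  rintro rfl
  have hYH : Y H = C.ham (-C.eta Y + g) H + g * C.reeb H := by
    conv_lhs => rw [hY]
    simp only [Derivation.add_apply, Derivation.smul_apply, smul_eq_mul]
  rw [hYH, ExactContact.jacobi]
  constructor <;> intro h <;> linear_combination h
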